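/- Let α be irrational and fix n > 0. Suppose there are real numbers 0 < B < A < 1/2, a positive integer ℓ, and β ∈ T such that ‖i/q_n − β‖ ≥ A/q_n for every 0 ≤ i < q_n, and ℓ + 1 ≤ B·a_{n+1}. Then for every x ∈ E_{n,ℓ} one has Σ_{k=0}^{ℓ q_n − 1} 1/‖x + kα − β‖ < 2 ℓ q_n (A⁻¹ + log(A⁻¹ q_n)) / (1 − B/A). -/

import Mathlib

/-- The complete quotients of the continued fraction expansion of `α`
(`cfQuot α 0 = α`, and `cfQuot α (n+1)` is the inverse of the fractional part
of `cfQuot α n`). -/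
noncomputable def cfQuot (α : ℝ) : ℕ → ℝ
  | 0 => α
  | n + 1 => (cfQuot α n - ⌊cfQuot α n⌋)⁻¹

/-- The partial quotients `aₙ` of the continued fraction expansion
`α = [a₀; a₁, a₂, …]` (as natural numbers; for irrational `α` and `n ≥ 1`
one has `cfa α n ≥ 1`). -/
noncomputable def cfa (α : ℝ) (n : ℕ) : ℕ := (⌊cfQuot α n⌋).toNat

/-- The denominators `qₙ` of the convergents `pₙ/qₙ` of `α`:
`q₀ = 1`, `q₁ = a₁` and `q_{n+2} = a_{n+2} q_{n+1} + q_n`. -/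
noncomputable def cfq (α : ℝ) : ℕ → ℕ
  | 0 => 1
  | 1 => cfa α 1
  | n + 2 => cfa α (n + 2) * cfq α (n + 1) + cfq α n

/-- The numerators `pₙ` of the convergents `pₙ/qₙ` of `α`:
`p₀ = a₀`, `p₁ = a₁ a₀ + 1` and `p_{n+2} = a_{n+2} p_{n+1} + pₙ`. -/
noncomputable def cfp (α : ℝ) : ℕ → ℤ
  | 0 => ⌊α⌋
  | 1 => (cfa α 1 : ℤ) * ⌊α⌋ + 1
  | n + 2 => (cfa α (n + 2) : ℤ) * cfp α (n + 1) + cfp α n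

/-- `ρₙ = qₙ α − pₙ`. -/
noncomputable def cfrho (α : ℝ) (n : ℕ) : ℝ := (cfq α n : ℝ) * α - (cfp α n : ℝ)

/-- `λ⁽ⁿ⁾ = |ρₙ| = ‖qₙ α‖`, the distance from `qₙ α` to the nearest integer. -/
noncomputable def cflam (α : ℝ) (n : ℕ) : ℝ := |cfrho α n|

section ContinuedFractions

lemma irrational_cfQuot {α : ℝ} (hα : Irrational α) (n : ℕ) : Irrational (cfQuot α n) := by
  induction n with
  | zero => exact hα
  | succ n ih => exact irrational_inv_iff.2 (ih.sub_intCast _)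

lemma one_lt_cfQuot_succ {α : ℝ} (hα : Irrational α) (n : ℕ) : 1 < cfQuot α (n + 1) := by
  have hpos : 0 < cfQuot α n - ⌊cfQuot α n⌋ :=
    sub_pos.2 ((Int.floor_le _).lt_of_ne ((irrational_cfQuot hα n).ne_int _).symm)
  exact (one_lt_inv₀ hpos).2 (by linarith [Int.lt_floor_add_one (cfQuot α n)])

lemma cfQuot_mul_sub_floor {α : ℝ} (hα : Irrational α) (n : ℕ) :
    cfQuot α (n + 1) * (cfQuot α n - ⌊cfQuot α n⌋) = 1 :=
  inv_mul_cancel₀ (sub_ne_zero.2 ((irrational_cfQuot hα n).ne_int _))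

lemma cast_cfa_succ {α : ℝ} (hα : Irrational α) (n : ℕ) :
    (cfa α (n + 1) : ℝ) = ⌊cfQuot α (n + 1)⌋ := by
  have h : 0 ≤ ⌊cfQuot α (n + 1)⌋ :=
    Int.floor_nonneg.2 (zero_le_one.trans (one_lt_cfQuot_succ hα n).le)
  exact_mod_cast congrArg (Int.cast : ℤ → ℝ) (Int.toNat_of_nonneg h)

lemma cfa_succ_pos {α : ℝ} (hα : Irrational α) (n : ℕ) : 0 < cfa α (n + 1) := by
  have h : 1 ≤ ⌊cfQuot α (n + 1)⌋ :=
    Int.le_floor.2 (by exact_mod_cast (one_lt_cfQuot_succ hα n).le)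
  unfold cfa
  omega

lemma cfq_pos {α : ℝ} (hα : Irrational α) (n : ℕ) : 0 < cfq α n := by
  induction n using Nat.twoStepInduction with
  | zero => exact Nat.one_pos
  | one => exact cfa_succ_pos hα 0
  | more n ih _ => exact Nat.add_pos_right _ ih

lemma cfp_mul_cfq_sub (α : ℝ) (n : ℕ) :
    cfp α (n + 1) * (cfq α n : ℤ) - cfp α n * (cfq α (n + 1) : ℤ) = (-1) ^ n := by
  induction n with
  | zero => simp [cfp, cfq]; ring
  | succ n ih =>
    have hp : cfp α (n + 2) = (cfa α (n + 2) : ℤ) * cfp α (n + 1) + cfp α n := rfl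
    have hq : cfq α (n + 2) = cfa α (n + 2) * cfq α (n + 1) + cfq α n := rfl
    rw [hp, hq, pow_succ, ← ih]
    push_cast
    ring

lemma isCoprime_cfp_cfq (α : ℝ) (n : ℕ) : IsCoprime (cfp α n) (cfq α n : ℤ) := by
  have h := cfp_mul_cfq_sub α n
  have hs : ((-1 : ℤ) ^ n) * (-1) ^ n = 1 := by rw [← mul_pow]; simp
  exact ⟨-(-1) ^ n * cfq α (n + 1), (-1) ^ n * cfp α (n + 1), by
    linear_combination (-1) ^ n * h + hs⟩

lemma cfrho_add_two (α : ℝ) (n : ℕ) :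
    cfrho α (n + 2) = cfa α (n + 2) * cfrho α (n + 1) + cfrho α n := by
  simp only [cfrho, cfp, cfq]
  push_cast
  ring

lemma cfQuot_mul_cfrho_succ {α : ℝ} (hα : Irrational α) (n : ℕ) :
    cfQuot α (n + 2) * cfrho α (n + 1) = -cfrho α n := by
  induction n with
  | zero =>
    have h0 : cfQuot α 1 * (α - ⌊α⌋) = 1 := cfQuot_mul_sub_floor hα 0
    have h1 := cfQuot_mul_sub_floor hα 1
    rw [← cast_cfa_succ hα 0] at h1
    simp only [cfrho, cfp, cfq, zero_add] at h1 ⊢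
    push_cast
    linear_combination (-(α - ⌊α⌋)) * h1 + cfQuot α 2 * h0
  | succ n ih =>
    have h1 := cfQuot_mul_sub_floor hα (n + 2)
    rw [← cast_cfa_succ hα (n + 1)] at h1
    rw [cfrho_add_two]
    linear_combination cfQuot α (n + 3) * ih - cfrho α (n + 1) * h1

lemma cflam_mul_cfq_succ_le_one {α : ℝ} (hα : Irrational α) (n : ℕ) :
    cflam α n * cfq α (n + 1) ≤ 1 := by
  have hx : 0 < cfQuot α (n + 2) := zero_lt_one.trans (one_lt_cfQuot_succ hα (n + 1))
  have hdet : (cfp α (n + 1) : ℝ) * cfq α n - cfp α n * cfq α (n + 1) = (-1) ^ n := by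
    exact_mod_cast congrArg (Int.cast : ℤ → ℝ) (cfp_mul_cfq_sub α n)
  have hmul : cfrho α n * (cfq α (n + 1) + cfq α n / cfQuot α (n + 2)) = (-1) ^ n := by
    have hr : cfrho α (n + 1) = -cfrho α n / cfQuot α (n + 2) := by
      rw [eq_div_iff hx.ne', mul_comm, cfQuot_mul_cfrho_succ hα]
    calc cfrho α n * (cfq α (n + 1) + cfq α n / cfQuot α (n + 2))
        = cfrho α n * cfq α (n + 1) - cfq α n * cfrho α (n + 1) := by rw [hr]; ring
      _ = (-1) ^ n := by rw [← hdet]; simp only [cfrho]; ring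
  have hquot : 0 ≤ (cfq α n : ℝ) / cfQuot α (n + 2) := by positivity
  have habs := congrArg abs hmul
  rw [abs_mul, abs_pow, abs_neg, abs_one, one_pow,
    abs_of_nonneg (add_nonneg (Nat.cast_nonneg (cfq α (n + 1))) hquot)] at habs
  rw [← habs]
  exact mul_le_mul_of_nonneg_left (le_add_of_nonneg_right hquot) (abs_nonneg _)

lemma cflam_mul_cfa_mul_cfq_le_one {α : ℝ} (hα : Irrational α) {n : ℕ} (hn : 0 < n) :
    cflam α n * (cfa α (n + 1) * cfq α n) ≤ 1 := by
  obtain ⟨m, rfl⟩ := Nat.exists_eq_succ_of_ne_zero hn.ne'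
  refine le_trans ?_ (cflam_mul_cfq_succ_le_one hα (m + 1))
  have hq : cfq α (m + 2) = cfa α (m + 2) * cfq α (m + 1) + cfq α m := rfl
  rw [hq]
  push_cast
  exact mul_le_mul_of_nonneg_left (le_add_of_nonneg_right (by positivity)) (abs_nonneg _)

end ContinuedFractions

section ResidueSums

lemma sum_range_natCast_zmod {q : ℕ} [NeZero q] (f : ZMod q → ℝ) :
    ∑ j ∈ Finset.range q, f j = ∑ z, f z :=
  Finset.sum_bij' (fun j _ => (j : ZMod q)) (fun z _ => z.val) (by simp)
    (fun z _ => Finset.mem_range.2 z.val_lt)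
    (fun j hj => ZMod.val_cast_of_lt (Finset.mem_range.1 hj)) (by simp) (by simp)

lemma sum_range_mul_natCast_zmod {q : ℕ} [NeZero q] (l : ℕ) (f : ZMod q → ℝ) :
    ∑ k ∈ Finset.range (l * q), f k = l * ∑ z, f z := by
  induction l with
  | zero => simp
  | succ l ih =>
    rw [Nat.succ_mul, Finset.sum_range_add, ih, ← sum_range_natCast_zmod]
    simp only [Nat.cast_add, Nat.cast_mul, CharP.cast_eq_zero, mul_zero, zero_add]
    push_cast
    ring

lemma sum_sub_mul_zmod {q : ℕ} [NeZero q] {u : ZMod q} (hu : IsUnit u) (c : ZMod q)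
    (f : ZMod q → ℝ) : ∑ z, f ((z - c) * u) = ∑ z, f z := by
  obtain ⟨u, rfl⟩ := hu
  exact Equiv.sum_comp ((Equiv.subRight c).trans u.mulRight) f

end ResidueSums

section CircleEstimates

lemma UnitAddCircle.norm_coe_le_abs (t : ℝ) : ‖(t : UnitAddCircle)‖ ≤ |t| := by
  simpa [UnitAddCircle.norm_eq] using round_le t 0

lemma UnitAddCircle.inv_norm_coe_lt {t : ℝ} (h0 : 0 < t) (h1 : t < 1) :
    ‖(t : UnitAddCircle)‖⁻¹ < t⁻¹ + (1 - t)⁻¹ := by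
  have h1' : 0 < 1 - t := sub_pos.2 h1
  have ht := inv_pos.2 h0
  have ht' := inv_pos.2 h1'
  rw [UnitAddCircle.norm_eq, abs_sub_round_eq_min, Int.fract_eq_self.2 ⟨h0.le, h1⟩]
  rcases min_choice t (1 - t) with h | h <;> rw [h] <;> linarith

lemma sum_inv_add_le {s : ℝ} (hs : 0 < s) (m : ℕ) :
    ∑ j ∈ Finset.range (m + 1), ((j : ℝ) + s)⁻¹ ≤ s⁻¹ + Real.log ((m + s) / s) := by
  induction m with
  | zero => simp [hs.ne']
  | succ m ih =>
    rw [Finset.sum_range_succ]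
    have h1 : (0 : ℝ) < m + s := by positivity
    have h2 : (0 : ℝ) < (m + 1 : ℕ) + s := by positivity
    have h := Real.one_sub_inv_le_log_of_pos (div_pos h2 h1)
    rw [inv_div, Real.log_div h2.ne' h1.ne'] at h
    have h3 : 1 - (m + s) / ((m + 1 : ℕ) + s) = ((m + 1 : ℕ) + s)⁻¹ := by
      field_simp
      push_cast
      ring
    rw [Real.log_div h1.ne' hs.ne'] at ih
    rw [Real.log_div h2.ne' hs.ne']
    linarith

lemma sum_inv_add_le_of_le {A s : ℝ} (hA : 0 < A) (hAs : A ≤ s) (hs : s ≤ 1) {q : ℕ}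
    (hq : 0 < q) :
    ∑ j ∈ Finset.range q, ((j : ℝ) + s)⁻¹ ≤ A⁻¹ + Real.log (A⁻¹ * q) := by
  obtain ⟨m, rfl⟩ := Nat.exists_eq_succ_of_ne_zero hq.ne'
  have hs0 := hA.trans_le hAs
  refine (sum_inv_add_le hs0 m).trans (add_le_add (inv_anti₀ hA hAs) ?_)
  refine Real.log_le_log (by positivity) ?_
  rw [div_eq_inv_mul]
  push_cast
  gcongr

lemma sum_inv_norm_toAddCircle_sub_lt {q : ℕ} [NeZero q] {A : ℝ} (hA : 0 < A)
    {β : UnitAddCircle} (hβ : ∀ z : ZMod q, A / q ≤ ‖ZMod.toAddCircle z - β‖) :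
    ∑ z : ZMod q, ‖ZMod.toAddCircle z - β‖⁻¹ < 2 * q * (A⁻¹ + Real.log (A⁻¹ * q)) := by
  obtain ⟨b, rfl⟩ := QuotientAddGroup.mk_surjective β
  have hq : 0 < q := NeZero.pos q
  have hq' : (0 : ℝ) < q := by exact_mod_cast hq
  set c : ℤ := ⌈q * b⌉ with hc
  set s : ℝ := c - q * b with hs
  have hcoe : ∀ j : ℤ, ZMod.toAddCircle ((j : ZMod q) + (c : ZMod q)) - (b : UnitAddCircle) =
      (((j + s) / q : ℝ) : UnitAddCircle) := by
    intro j
    rw [← Int.cast_add, ZMod.toAddCircle_intCast, ← AddCircle.coe_sub]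
    congr 1
    rw [hs]
    push_cast
    field_simp
    ring
  have hnorm : ∀ j : ℤ, A ≤ |j + s| := by
    intro j
    have h := (hβ (j + c)).trans ((congrArg norm (hcoe j)).le.trans
      (UnitAddCircle.norm_coe_le_abs _))
    rwa [abs_div, abs_of_pos hq', div_le_div_iff_of_pos_right hq'] at h
  have hs0 : 0 ≤ s := sub_nonneg.2 (Int.le_ceil _)
  have hs1 : s < 1 := by linarith [Int.ceil_lt_add_one (q * b)]
  have hAs : A ≤ s := by simpa [abs_of_nonneg hs0] using hnorm 0
  have hAs' : A ≤ 1 - s := by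
    have h := hnorm (-1)
    rw [abs_of_neg (by push_cast; linarith)] at h
    push_cast at h
    linarith
  have hsum : ∑ z : ZMod q, ‖ZMod.toAddCircle z - (b : UnitAddCircle)‖⁻¹ =
      ∑ j ∈ Finset.range q, ‖(((j + s) / q : ℝ) : UnitAddCircle)‖⁻¹ := by
    rw [← Equiv.sum_comp (Equiv.addRight (c : ZMod q)), ← sum_range_natCast_zmod]
    refine Finset.sum_congr rfl fun j _ => ?_
    simpa using congrArg (fun w => ‖w‖⁻¹) (hcoe j)
  have hterm : ∀ j ∈ Finset.range q, ‖(((j + s) / q : ℝ) : UnitAddCircle)‖⁻¹ <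
      q * ((j : ℝ) + s)⁻¹ + q * (((q - 1 - j : ℕ) : ℝ) + (1 - s))⁻¹ := by
    intro j hj
    have hj' : j + 1 ≤ q := Finset.mem_range.1 hj
    have hjr : (j : ℝ) + 1 ≤ q := by exact_mod_cast hj'
    have hjs : 0 < (j : ℝ) + s := by linarith [hA, (Nat.cast_nonneg j : (0 : ℝ) ≤ j)]
    have h := UnitAddCircle.inv_norm_coe_lt (div_pos hjs hq')
      ((div_lt_one hq').2 (by linarith))
    have hcast : ((q - 1 - j : ℕ) : ℝ) = q - 1 - j := by
      rw [Nat.cast_sub (by omega), Nat.cast_sub (by omega), Nat.cast_one]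
    refine h.trans_eq ?_
    have hne : (q : ℝ) - (j + s) ≠ 0 := by linarith
    rw [hcast, one_sub_div hq'.ne', inv_div, inv_div, div_eq_mul_inv, div_eq_mul_inv]
    ring_nf
  refine (hsum.trans_lt (Finset.sum_lt_sum_of_nonempty
    (Finset.nonempty_range_iff.2 hq.ne') hterm)).trans_le ?_
  rw [Finset.sum_add_distrib, ← Finset.mul_sum, ← Finset.mul_sum,
    Finset.sum_range_reflect (fun j : ℕ => ((j : ℝ) + (1 - s))⁻¹) q]
  have h1 := mul_le_mul_of_nonneg_left (sum_inv_add_le_of_le hA hAs hs1.le hq) hq'.le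
  have h2 := mul_le_mul_of_nonneg_left
    (sum_inv_add_le_of_le hA hAs' (by linarith) hq) hq'.le
  linarith

lemma inv_norm_le_of_norm_sub_le {E : Type*} [SeminormedAddCommGroup E] {y w : E} {a b : ℝ}
    (hb : 0 ≤ b) (hba : b < a) (hw : a ≤ ‖w‖) (hyw : ‖y - w‖ ≤ b) :
    ‖y‖⁻¹ ≤ ‖w‖⁻¹ / (1 - b / a) := by
  have ha : 0 < a := hb.trans_lt hba
  have hr : 0 < 1 - b / a := sub_pos.2 ((div_lt_one ha).2 hba)
  have h1 : b ≤ b / a * ‖w‖ := by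
    calc b = b / a * a := by field_simp
      _ ≤ b / a * ‖w‖ := mul_le_mul_of_nonneg_left hw (by positivity)
  have h2 : ‖w‖ * (1 - b / a) ≤ ‖y‖ := by
    linarith [norm_sub_norm_le w y, norm_sub_rev w y]
  rw [div_eq_mul_inv, ← mul_inv]
  exact inv_anti₀ (mul_pos (ha.trans_le hw) hr) h2

end CircleEstimates

lemma norm_add_nsmul_sub_toAddCircle_le {α : ℝ} {n l k k₀ : ℕ} [NeZero (cfq α n)]
    {x : UnitAddCircle} (hk : k < l * cfq α n) (hk₀ : k₀ < l * cfq α n)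
    (hx : ‖x + k₀ • (α : UnitAddCircle)‖ < cflam α n / 2) :
    ‖x + k • (α : UnitAddCircle) -
      ZMod.toAddCircle (((k : ZMod (cfq α n)) - (k₀ : ZMod (cfq α n))) * (cfp α n : ZMod (cfq α n)))‖ ≤
      (l + 1) * cflam α n := by
  set q := cfq α n with hq
  have hq' : (0 : ℝ) < q := by exact_mod_cast NeZero.pos q
  set t : ℝ := ((k : ℝ) - k₀) * (cfrho α n / q) with ht
  have hdecomp : x + k • (α : UnitAddCircle) -
      ZMod.toAddCircle (((k : ZMod q) - (k₀ : ZMod q)) * (cfp α n : ZMod q)) =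
      (x + k₀ • (α : UnitAddCircle)) + (t : UnitAddCircle) := by
    have h1 : ((k : ZMod q) - (k₀ : ZMod q)) * (cfp α n : ZMod q) =
        ((((k : ℤ) - k₀) * cfp α n : ℤ) : ZMod q) := by push_cast; rfl
    have h2 : t = k • α - k₀ • α - ((((k : ℤ) - k₀) * cfp α n : ℤ) : ℝ) / q := by
      rw [ht, cfrho, ← hq]
      push_cast
      simp only [nsmul_eq_mul]
      field_simp
    rw [h1, ZMod.toAddCircle_intCast, h2]
    simp only [AddCircle.coe_sub, AddCircle.coe_nsmul]
    abel
  have hkr : (k : ℝ) ≤ l * q := by exact_mod_cast hk.le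
  have hkr₀ : (k₀ : ℝ) ≤ l * q := by exact_mod_cast hk₀.le
  have htl : |t| ≤ l * cflam α n := by
    rw [ht, abs_mul, abs_div, abs_of_pos hq']
    calc |(k : ℝ) - k₀| * (|cfrho α n| / q) ≤ (l * q) * (|cfrho α n| / q) := by
          refine mul_le_mul_of_nonneg_right (abs_sub_le_iff.2 ⟨?_, ?_⟩) (by positivity)
          · linarith [(Nat.cast_nonneg k₀ : (0 : ℝ) ≤ k₀)]
          · linarith [(Nat.cast_nonneg k : (0 : ℝ) ≤ k)]
      _ = l * cflam α n := by rw [cflam]; field_simp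
  have hlam : 0 ≤ cflam α n := abs_nonneg _
  rw [hdecomp]
  linarith [norm_add_le (x + k₀ • (α : UnitAddCircle)) (t : UnitAddCircle),
    UnitAddCircle.norm_coe_le_abs t]

/-- Let `α` be irrational, `n > 0`, `0 < B < A < 1/2`,
`ℓ ≥ 1` and `β ∈ T` with `‖i/qₙ − β‖ ≥ A/qₙ` for all `0 ≤ i < qₙ` and
`ℓ + 1 ≤ B a_{n+1}`.  Then every `x ∈ E_{n,ℓ}` satisfies
`Σ_{k < ℓqₙ} ‖x + kα − β‖⁻¹ < 2 ℓ qₙ (A⁻¹ + log(A⁻¹ qₙ)) / (1 − B/A)`. -/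
theorem stmt_10 (α : ℝ) (hα : Irrational α) (n : ℕ) (hn : 0 < n)
    (A B : ℝ) (hB : 0 < B) (hBA : B < A) (hA : A < 1 / 2)
    (ℓ : ℕ) (hℓ : 0 < ℓ) (β : UnitAddCircle)
    (hβ : ∀ i < cfq α n,
      A / (cfq α n : ℝ) ≤ ‖(((i : ℝ) / (cfq α n : ℝ) : ℝ) : UnitAddCircle) - β‖)
    (hℓa : (ℓ : ℝ) + 1 ≤ B * (cfa α (n + 1) : ℝ))
    (x : UnitAddCircle)
    (hx : x ∈ ⋃ k ∈ Finset.range (ℓ * cfq α n),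
      (fun z : UnitAddCircle => z + k • (α : UnitAddCircle)) ⁻¹'
        {z : UnitAddCircle | ‖z‖ < cflam α n / 2}) :
    ∑ k ∈ Finset.range (ℓ * cfq α n), ‖x + k • (α : UnitAddCircle) - β‖⁻¹ <
      2 * ((ℓ : ℝ) * (cfq α n : ℝ)) * (A⁻¹ + Real.log (A⁻¹ * (cfq α n : ℝ))) /
        (1 - B / A) := by
  have hA0 : 0 < A := hB.trans hBA
  have hqpos := cfq_pos hα n
  have : NeZero (cfq α n) := ⟨hqpos.ne'⟩
  have hq' : (0 : ℝ) < cfq α n := by exact_mod_cast hqpos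
  have hl' : (0 : ℝ) < ℓ := by exact_mod_cast hℓ
  have hr : 0 < 1 - B / A := sub_pos.2 ((div_lt_one hA0).2 hBA)
  simp only [Set.mem_iUnion, Finset.mem_range, Set.mem_preimage, Set.mem_ofPred_eq] at hx
  obtain ⟨k₀, hk₀, hx⟩ := hx
  have hβ' : ∀ z : ZMod (cfq α n), A / cfq α n ≤ ‖ZMod.toAddCircle z - β‖ := fun z => by
    rw [ZMod.toAddCircle_apply]
    exact hβ z.val z.val_lt
  have hclose : ((ℓ : ℝ) + 1) * cflam α n ≤ B / cfq α n := by
    rw [le_div_iff₀ hq']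
    have hlam : 0 ≤ cflam α n := abs_nonneg _
    calc ((ℓ : ℝ) + 1) * cflam α n * cfq α n
        ≤ B * cfa α (n + 1) * cflam α n * cfq α n := by gcongr
      _ = B * (cflam α n * (cfa α (n + 1) * cfq α n)) := by ring
      _ ≤ B := mul_le_of_le_one_right hB.le (cflam_mul_cfa_mul_cfq_le_one hα hn)
  set u : ZMod (cfq α n) := (cfp α n : ZMod (cfq α n))
  have hu : IsUnit u := (ZMod.coe_int_isUnit_iff_isCoprime _ _).2 (isCoprime_cfp_cfq α n).symm
  set c : ZMod (cfq α n) := (k₀ : ZMod (cfq α n))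
  have hterm : ∀ k ∈ Finset.range (ℓ * cfq α n), ‖x + k • (α : UnitAddCircle) - β‖⁻¹ ≤
      ‖ZMod.toAddCircle (((k : ZMod (cfq α n)) - c) * u) - β‖⁻¹ / (1 - B / A) := by
    intro k hk
    have h := inv_norm_le_of_norm_sub_le (y := x + k • (α : UnitAddCircle) - β)
      (by positivity) (div_lt_div_of_pos_right hBA hq')
      (hβ' (((k : ZMod (cfq α n)) - c) * u)) (by
        rw [sub_sub_sub_cancel_right]
        exact (norm_add_nsmul_sub_toAddCircle_le (Finset.mem_range.1 hk) hk₀ hx).trans hclose)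
    rwa [div_div_div_cancel_right₀ hq'.ne'] at h
  calc ∑ k ∈ Finset.range (ℓ * cfq α n), ‖x + k • (α : UnitAddCircle) - β‖⁻¹
      ≤ ∑ k ∈ Finset.range (ℓ * cfq α n),
          ‖ZMod.toAddCircle (((k : ZMod (cfq α n)) - c) * u) - β‖⁻¹ / (1 - B / A) :=
        Finset.sum_le_sum hterm
    _ = (ℓ * ∑ z : ZMod (cfq α n), ‖ZMod.toAddCircle z - β‖⁻¹) / (1 - B / A) := by
        rw [← Finset.sum_div, sum_range_mul_natCast_zmod ℓ fun z : ZMod (cfq α n) =>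
            ‖ZMod.toAddCircle ((z - c) * u) - β‖⁻¹,
          sum_sub_mul_zmod hu c fun z => ‖ZMod.toAddCircle z - β‖⁻¹]
    _ < (ℓ * (2 * cfq α n * (A⁻¹ + Real.log (A⁻¹ * cfq α n)))) / (1 - B / A) :=
        div_lt_div_of_pos_right
          (mul_lt_mul_of_pos_left (sum_inv_norm_toAddCircle_sub_lt hA0 hβ') hl') hr
    _ = _ := by ring
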